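/- arXiv:2309.04856 — 2 statements merged into one kernel-verified Lean document; each statement's English description precedes it below -/
import Mathlib

section
/- Let Φ be a full-rank real l × n matrix with l ≥ n and Moore–Penrose pseudoinverse Φ⁺ (so Φ⁺Φ = I_n), let k ∈ ℕ, and let S_k = { v ∈ ℝ^n : Φv has at most k nonzero entries }, with proj_{S_k} a nearest-point projection onto S_k. Let H be a real m × n matrix and δ ∈ [0, 1) be such that (1 − δ)‖u − v‖₂² ≤ ‖H(u − v)‖₂² for all u, v ∈ S_k. Then for all f₁, f₂ ∈ ℝ^n, writing f_i^S = proj_{S_k}(f_i), one has ‖f₁ − f₂‖₂ ≤ α( ‖f₁ − f₁^S‖₂ + ‖Φ⁺‖₂ · ‖Φf₂ − Φf₂^S‖₂ ) + (1/√(1 − δ)) ‖Hf₁ − Hf₂‖₂, where α = 1 + ‖H‖₂ / √(1 − δ) and ‖·‖₂ on matrices denotes the spectral norm. -/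
open Classical in
/-- `S_k = { v ∈ ℝ^n : Φv has at most k nonzero entries }`, the set of vectors
`k`-sparse with respect to `Φ`. -/
noncomputable def sparseSet {n l : ℕ}
    (Φ : EuclideanSpace ℝ (Fin n) →L[ℝ] EuclideanSpace ℝ (Fin l)) (k : ℕ) :
    Set (EuclideanSpace ℝ (Fin n)) :=
  {v | (Finset.univ.filter fun i => Φ v i ≠ 0).card ≤ k}

/- STATEMENT 10: the deterministic compressed-sensing inequality
`‖f₁ − f₂‖₂ ≤ α(‖f₁ − f₁^S‖₂ + ‖Φ⁺‖₂‖Φf₂ − Φf₂^S‖₂) + (1/√(1−δ))‖Hf₁ − Hf₂‖₂`,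
with `α = 1 + ‖H‖₂/√(1−δ)`. -/
theorem stmt_10 {n m l k : ℕ} (hln : n ≤ l)
    (Φ : EuclideanSpace ℝ (Fin n) →L[ℝ] EuclideanSpace ℝ (Fin l))
    (Φp : EuclideanSpace ℝ (Fin l) →L[ℝ] EuclideanSpace ℝ (Fin n))
    -- `Φ` is full-rank with Moore–Penrose pseudoinverse `Φ⁺`, so `Φ⁺Φ = I_n`
    (hΦp : ∀ v, Φp (Φ v) = v)
    -- `proj_{S_k}` is a nearest-point projection onto `S_k`
    (projS : EuclideanSpace ℝ (Fin n) → EuclideanSpace ℝ (Fin n))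
    (hproj_mem : ∀ f, projS f ∈ sparseSet Φ k)
    (hproj_near : ∀ f, ∀ s ∈ sparseSet Φ k, ‖f - projS f‖ ≤ ‖f - s‖)
    (H : EuclideanSpace ℝ (Fin n) →L[ℝ] EuclideanSpace ℝ (Fin m))
    (δ : ℝ) (hδ0 : 0 ≤ δ) (hδ1 : δ < 1)
    -- lower restricted-isometry inequality on differences of elements of `S_k`
    (hRIP : ∀ u ∈ sparseSet Φ k, ∀ v ∈ sparseSet Φ k,
      (1 - δ) * ‖u - v‖ ^ 2 ≤ ‖H (u - v)‖ ^ 2)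
    (f₁ f₂ : EuclideanSpace ℝ (Fin n)) :
    ‖f₁ - f₂‖ ≤
      (1 + ‖H‖ / Real.sqrt (1 - δ)) *
        (‖f₁ - projS f₁‖ + ‖Φp‖ * ‖Φ f₂ - Φ (projS f₂)‖)
      + (1 / Real.sqrt (1 - δ)) * ‖H f₁ - H f₂‖ := by
  have hc : 0 < Real.sqrt (1 - δ) := Real.sqrt_pos.mpr (by linarith)
  have hsparse : Real.sqrt (1 - δ) * ‖projS f₁ - projS f₂‖ ≤ ‖H (projS f₁ - projS f₂)‖ := by
    refine le_of_pow_le_pow_left₀ two_ne_zero (norm_nonneg _) ?_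
    rw [mul_pow, Real.sq_sqrt (by linarith)]
    exact hRIP _ (hproj_mem f₁) _ (hproj_mem f₂)
  have hf₂ : ‖f₂ - projS f₂‖ ≤ ‖Φp‖ * ‖Φ f₂ - Φ (projS f₂)‖ := by
    simpa only [map_sub, hΦp] using Φp.le_opNorm (Φ f₂ - Φ (projS f₂))
  have htri : ‖f₁ - f₂‖ ≤ ‖f₁ - projS f₁‖ + ‖f₂ - projS f₂‖ + ‖projS f₁ - projS f₂‖ := by
    calc ‖f₁ - f₂‖ = ‖(f₁ - projS f₁) - (f₂ - projS f₂) + (projS f₁ - projS f₂)‖ := by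
          congr 1; abel
      _ ≤ _ := (norm_add_le _ _).trans (by gcongr; exact norm_sub_le _ _)
  have hH : ‖H (projS f₁ - projS f₂)‖ ≤
      ‖H‖ * (‖f₁ - projS f₁‖ + ‖f₂ - projS f₂‖) + ‖H f₁ - H f₂‖ := by
    calc ‖H (projS f₁ - projS f₂)‖
        = ‖(H f₁ - H f₂) - (H (f₁ - projS f₁) - H (f₂ - projS f₂))‖ := by
          simp only [map_sub]; congr 1; abel
      _ ≤ ‖H f₁ - H f₂‖ + (‖H (f₁ - projS f₁)‖ + ‖H (f₂ - projS f₂)‖) :=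
          (norm_sub_le _ _).trans (by gcongr; exact norm_sub_le _ _)
      _ ≤ ‖H f₁ - H f₂‖ + (‖H‖ * ‖f₁ - projS f₁‖ + ‖H‖ * ‖f₂ - projS f₂‖) := by
          gcongr <;> exact H.le_opNorm _
      _ = _ := by ring
  have hdist : ‖projS f₁ - projS f₂‖ ≤
      (‖H‖ * (‖f₁ - projS f₁‖ + ‖f₂ - projS f₂‖) + ‖H f₁ - H f₂‖) / Real.sqrt (1 - δ) := by
    rw [le_div_iff₀' hc]
    exact hsparse.trans hH
  calc ‖f₁ - f₂‖
      ≤ ‖f₁ - projS f₁‖ + ‖f₂ - projS f₂‖ +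
          (‖H‖ * (‖f₁ - projS f₁‖ + ‖f₂ - projS f₂‖) + ‖H f₁ - H f₂‖) / Real.sqrt (1 - δ) :=
        htri.trans (by gcongr)
    _ = (1 + ‖H‖ / Real.sqrt (1 - δ)) * (‖f₁ - projS f₁‖ + ‖f₂ - projS f₂‖)
          + (1 / Real.sqrt (1 - δ)) * ‖H f₁ - H f₂‖ := by ring
    _ ≤ _ := by gcongr
end

section
/- Let Φ be a full-rank real l × n matrix with l ≥ n and Moore–Penrose pseudoinverse Φ⁺, let k ∈ ℕ, S_k = { v ∈ ℝ^n : Φv has at most k nonzero entries }, and proj_{S_k} a measurable nearest-point projection onto S_k. Let H be a real m × n matrix and δ ∈ [0, 1) with (1 − δ)‖u − v‖₂² ≤ ‖H(u − v)‖₂² for all u, v ∈ S_k, and set α = 1 + ‖H‖₂/√(1 − δ). Let q and p be probability measures on ℝ^n with finite first moments such that ∫ ‖f − proj_{S_k}(f)‖₂ dq(f) ≤ ε′ and ∫ ‖Φf − Φ proj_{S_k}(f)‖₂ dp(f) ≤ ε. Then W₁(q, p) ≤ α( ε′ + ‖Φ⁺‖₂ ε ) + (1/√(1 − δ)) · inf_{γ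 ∈ Γ(q,p)} ∫ ‖Hf₁ − Hf₂‖₂ dγ(f₁, f₂). -/
open MeasureTheory
open scoped ENNReal

/-- The Wasserstein-1 distance on ℝ^n: the infimum over all couplings `γ` of `μ` and `ν`
of `∫ ‖x − y‖₂ dγ(x, y)`. -/
noncomputable def wasserstein1 {n : ℕ} (μ ν : Measure (EuclideanSpace ℝ (Fin n))) : ℝ≥0∞ :=
  ⨅ (γ : Measure (EuclideanSpace ℝ (Fin n) × EuclideanSpace ℝ (Fin n)))
    (_ : γ.map Prod.fst = μ ∧ γ.map Prod.snd = ν),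
    ∫⁻ p, edist p.1 p.2 ∂γ

theorem zero_mem_sparseSet {n l : ℕ}
    (Φ : EuclideanSpace ℝ (Fin n) →L[ℝ] EuclideanSpace ℝ (Fin l)) (k : ℕ) :
    (0 : EuclideanSpace ℝ (Fin n)) ∈ sparseSet Φ k := by
  simp [sparseSet]

/-- If `H` is bounded below by `s` on the difference of `x'` and `y'`, then `‖x - y‖` is controlled
by `‖H x - H y‖` and the distances from `x` to `x'` and from `y` to `y'`. -/
theorem norm_sub_le_of_bounded_below {E F : Type*} [NormedAddCommGroup E] [NormedSpace ℝ E]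
    [NormedAddCommGroup F] [NormedSpace ℝ F] (H : E →L[ℝ] F) {s : ℝ} (hs : 0 < s) {x y x' y' : E}
    (h : s * ‖x' - y'‖ ≤ ‖H (x' - y')‖) :
    ‖x - y‖ ≤ (1 + ‖H‖ / s) * (‖x - x'‖ + ‖y - y'‖) + 1 / s * ‖H x - H y‖ := by
  have h₁ : ‖x - y‖ ≤ ‖x - x'‖ + ‖x' - y'‖ + ‖y - y'‖ := by
    have := norm_add₃_le (a := x - x') (b := x' - y') (c := y' - y)
    rwa [norm_sub_rev y' y, show x - x' + (x' - y') + (y' - y) = x - y by abel] at this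
  have h₂ : ‖H (x' - y')‖ ≤ ‖H x - H y‖ + ‖H‖ * (‖x - x'‖ + ‖y - y'‖) := by
    have := norm_add₃_le (a := H x - H y) (b := -H (x - x')) (c := H (y - y'))
    rw [show H x - H y + -H (x - x') + H (y - y') = H (x' - y') by simp only [map_sub]; abel,
      norm_neg] at this
    linarith [H.le_opNorm (x - x'), H.le_opNorm (y - y')]
  have h₃ : ‖x' - y'‖ ≤ (‖H x - H y‖ + ‖H‖ * (‖x - x'‖ + ‖y - y'‖)) / s := by
    rw [le_div_iff₀ hs]
    linarith
  calc ‖x - y‖ ≤ ‖x - x'‖ + (‖H x - H y‖ + ‖H‖ * (‖x - x'‖ + ‖y - y'‖)) / s + ‖y - y'‖ := by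
        linarith
    _ = _ := by ring

/- STATEMENT 11: `W₁(q, p) ≤ α(ε′ + ‖Φ⁺‖₂ ε) + (1/√(1−δ)) inf_{γ∈Γ(q,p)} ∫ ‖Hf₁ − Hf₂‖₂ dγ`,
with `α = 1 + ‖H‖₂/√(1−δ)`. -/
theorem stmt_11 {n m l k : ℕ} (hln : n ≤ l)
    (Φ : EuclideanSpace ℝ (Fin n) →L[ℝ] EuclideanSpace ℝ (Fin l))
    (Φp : EuclideanSpace ℝ (Fin l) →L[ℝ] EuclideanSpace ℝ (Fin n))
    -- `Φ` is full-rank with Moore–Penrose pseudoinverse `Φ⁺`, so `Φ⁺Φ = I_n`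
    (hΦp : ∀ v, Φp (Φ v) = v)
    -- `proj_{S_k}` is a measurable nearest-point projection onto `S_k`
    (projS : EuclideanSpace ℝ (Fin n) → EuclideanSpace ℝ (Fin n))
    (hproj_meas : Measurable projS)
    (hproj_mem : ∀ f, projS f ∈ sparseSet Φ k)
    (hproj_near : ∀ f, ∀ s ∈ sparseSet Φ k, ‖f - projS f‖ ≤ ‖f - s‖)
    (H : EuclideanSpace ℝ (Fin n) →L[ℝ] EuclideanSpace ℝ (Fin m))
    (δ : ℝ) (hδ0 : 0 ≤ δ) (hδ1 : δ < 1)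
    -- lower restricted-isometry inequality on differences of elements of `S_k`
    (hRIP : ∀ u ∈ sparseSet Φ k, ∀ v ∈ sparseSet Φ k,
      (1 - δ) * ‖u - v‖ ^ 2 ≤ ‖H (u - v)‖ ^ 2)
    (q p : Measure (EuclideanSpace ℝ (Fin n)))
    [IsProbabilityMeasure q] [IsProbabilityMeasure p]
    -- finite first moments
    (hq_moment : Integrable (fun f => ‖f‖) q)
    (hp_moment : Integrable (fun f => ‖f‖) p)
    (ε' ε : ℝ)
    (hq_sparse : ∫ f, ‖f - projS f‖ ∂q ≤ ε')
    (hp_sparse : ∫ f, ‖Φ f - Φ (projS f)‖ ∂p ≤ ε) :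
    wasserstein1 q p ≤
      ENNReal.ofReal ((1 + ‖H‖ / Real.sqrt (1 - δ)) * (ε' + ‖Φp‖ * ε))
      + ENNReal.ofReal (1 / Real.sqrt (1 - δ)) *
        ⨅ (γ : Measure (EuclideanSpace ℝ (Fin n) × EuclideanSpace ℝ (Fin n)))
          (_ : γ.map Prod.fst = q ∧ γ.map Prod.snd = p),
          ∫⁻ x, edist (H x.1) (H x.2) ∂γ := by
  have hs : 0 < Real.sqrt (1 - δ) := Real.sqrt_pos.2 (by linarith)
  set s := Real.sqrt (1 - δ) with hs_def
  have hα : 0 ≤ 1 + ‖H‖ / s := by positivity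
  set α := 1 + ‖H‖ / s
  have h_below : ∀ x y, s * ‖projS x - projS y‖ ≤ ‖H (projS x - projS y)‖ := fun x y ↦ by
    refine abs_le_of_sq_le_sq' ?_ (norm_nonneg _) |>.2
    rw [mul_pow, hs_def, Real.sq_sqrt (by linarith)]
    exact hRIP _ (hproj_mem x) _ (hproj_mem y)
  have h_near : ∀ f, ‖f - projS f‖ ≤ ‖f‖ := fun f ↦ by
    simpa using hproj_near f 0 (zero_mem_sparseSet Φ k)
  have h_residual : ∀ f, ‖f - projS f‖ ≤ ‖Φp‖ * ‖Φ f - Φ (projS f)‖ := fun f ↦ by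
    simpa [map_sub, hΦp] using Φp.le_opNorm (Φ f - Φ (projS f))
  have hq_int : Integrable (fun f ↦ ‖f - projS f‖) q :=
    hq_moment.mono' (by fun_prop) (.of_forall fun f ↦ by simpa using h_near f)
  have hp_int : Integrable (fun f ↦ ‖f - projS f‖) p :=
    hp_moment.mono' (by fun_prop) (.of_forall fun f ↦ by simpa using h_near f)
  have hp_int' : Integrable (fun f ↦ ‖Φ f - Φ (projS f)‖) p := by
    refine (hp_moment.const_mul ‖Φ‖).mono' (by fun_prop) (.of_forall fun f ↦ ?_)
    rw [norm_norm, ← map_sub]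
    exact (Φ.le_opNorm _).trans (by gcongr; exact h_near f)
  have hp_le : ∫ f, ‖f - projS f‖ ∂p ≤ ‖Φp‖ * ε :=
    calc ∫ f, ‖f - projS f‖ ∂p ≤ ∫ f, ‖Φp‖ * ‖Φ f - Φ (projS f)‖ ∂p :=
          integral_mono hp_int (hp_int'.const_mul _) h_residual
      _ = ‖Φp‖ * ∫ f, ‖Φ f - Φ (projS f)‖ ∂p := integral_const_mul _ _
      _ ≤ ‖Φp‖ * ε := by gcongr
  have h_lintegral : ENNReal.ofReal α *
      (∫⁻ f, ENNReal.ofReal ‖f - projS f‖ ∂q + ∫⁻ f, ENNReal.ofReal ‖f - projS f‖ ∂p)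
      ≤ ENNReal.ofReal (α * (ε' + ‖Φp‖ * ε)) := by
    rw [← ofReal_integral_eq_lintegral_ofReal hq_int (.of_forall fun _ ↦ norm_nonneg _),
      ← ofReal_integral_eq_lintegral_ofReal hp_int (.of_forall fun _ ↦ norm_nonneg _),
      ← ENNReal.ofReal_add (integral_nonneg fun _ ↦ norm_nonneg _)
        (integral_nonneg fun _ ↦ norm_nonneg _), ← ENNReal.ofReal_mul hα]
    gcongr
  have h_iInf_ne : ENNReal.ofReal (1 / s) ≠ 0 := by simpa using hs
  simp_rw [ENNReal.mul_iInf_of_ne h_iInf_ne ENNReal.ofReal_ne_top, ENNReal.add_iInf]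
  refine le_iInf fun γ ↦ ?_
  by_cases hγ : γ.map Prod.fst = q ∧ γ.map Prod.snd = p
  swap
  · simp [hγ]
  simp only [hγ, and_self, iInf_pos]
  refine (iInf₂_le γ hγ).trans ?_
  have h_meas : Measurable fun f ↦ ENNReal.ofReal ‖f - projS f‖ := by fun_prop
  calc ∫⁻ x, edist x.1 x.2 ∂γ
      ≤ ∫⁻ x, (ENNReal.ofReal α *
          (ENNReal.ofReal ‖x.1 - projS x.1‖ + ENNReal.ofReal ‖x.2 - projS x.2‖)
          + ENNReal.ofReal (1 / s) * edist (H x.1) (H x.2)) ∂γ := by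
        refine lintegral_mono fun x ↦ ?_
        rw [edist_dist, edist_dist, dist_eq_norm, dist_eq_norm,
          ← ENNReal.ofReal_add (by positivity) (by positivity), ← ENNReal.ofReal_mul hα,
          ← ENNReal.ofReal_mul (by positivity),
          ← ENNReal.ofReal_add (by positivity) (by positivity)]
        exact ENNReal.ofReal_le_ofReal (norm_sub_le_of_bounded_below H hs (h_below x.1 x.2))
    _ = ENNReal.ofReal α *
          (∫⁻ f, ENNReal.ofReal ‖f - projS f‖ ∂q + ∫⁻ f, ENNReal.ofReal ‖f - projS f‖ ∂p)
        + ENNReal.ofReal (1 / s) * ∫⁻ x, edist (H x.1) (H x.2) ∂γ := by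
        rw [lintegral_add_left (by fun_prop), lintegral_const_mul _ (by fun_prop),
          lintegral_add_left (by fun_prop), lintegral_const_mul' _ _ ENNReal.ofReal_ne_top,
          ← hγ.1, ← hγ.2, lintegral_map h_meas measurable_fst, lintegral_map h_meas measurable_snd]
    _ ≤ _ := by gcongr
end
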